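/- There exists an absolute constant C > 0 with the following property. Let α, β ≥ 0, let n ≥ 1 be an integer, let q ∈ (0,1), and let t ≥ 0 satisfy (1-q^n)·t < 1. Set u_{n,t} = ([n]_q·t + α + R_{n,t}·D_qA(1))/([n]_q+β), where R_{n,t} = e_q^{q·[n]_q t}·E_q^{-[n]_q t}/A(1). Then for every function f : [0,∞) → ℝ that is bounded and continuous and every x ≥ 0, |T_{n,t}^{α,β}(f;q;x) − f(x+t)| ≤ C·ω₂(f, δ_{n,t}(x)) + ω(f, |u_{n,t} − t|), where δ_{n,t}(x) = ( T_{n,t}^{α,β}(s ↦ (s − (x+t))²; q; x) + (u_{n,t} − t)² )^{1/2}. -/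

import Mathlib

open Filter

/-- The `q`-integer `[n]_q = (1 - q^n)/(1 - q)`. -/
noncomputable def qInt (q : ℝ) (n : ℕ) : ℝ := (1 - q ^ n) / (1 - q)

/-- The `q`-factorial `[n]_q! = [1]_q [2]_q ⋯ [n]_q`, with `[0]_q! = 1`. -/
noncomputable def qFact (q : ℝ) (n : ℕ) : ℝ := ∏ i ∈ Finset.range n, qInt q (i + 1)

/-- The `q`-exponential `e_q^x = ∑ x^n/[n]_q!`. -/
noncomputable def qExp (q x : ℝ) : ℝ := ∑' n : ℕ, x ^ n / qFact q n

/-- The `q`-exponential `E_q^x = ∑ q^{n(n-1)/2} x^n/[n]_q!`. -/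
noncomputable def qExpE (q x : ℝ) : ℝ := ∑' n : ℕ, q ^ (n * (n - 1) / 2) * x ^ n / qFact q n

/-- The power series `A(u) = ∑ c_k u^k`. -/
noncomputable def APow (c : ℕ → ℝ) (u : ℝ) : ℝ := ∑' k : ℕ, c k * u ^ k

/-- The `q`-Appell polynomial `P_k(q;y) = [k]_q! ∑_{j=0}^k c_j y^{k-j}/[k-j]_q!`. -/
noncomputable def qAppell (c : ℕ → ℝ) (q y : ℝ) (k : ℕ) : ℝ :=
  qFact q k * ∑ j ∈ Finset.range (k + 1), c j * y ^ (k - j) / qFact q (k - j)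

/-- `D_q A(1) = (A(1) - A(q))/(1-q)`. -/
noncomputable def DqA1 (c : ℕ → ℝ) (q : ℝ) : ℝ := (APow c 1 - APow c q) / (1 - q)

/-- `D_q A(q) = (A(q) - A(q²))/((1-q) q)`. -/
noncomputable def DqAq (c : ℕ → ℝ) (q : ℝ) : ℝ := (APow c q - APow c (q ^ 2)) / ((1 - q) * q)

/-- `D_q² A(1) = (D_q A(1) - D_q A(q))/(1-q)`. -/
noncomputable def Dq2A1 (c : ℕ → ℝ) (q : ℝ) : ℝ := (DqA1 c q - DqAq c q) / (1 - q)

/-- The Stancu-type `q`-Favard–Szász operator `T_{n,t}^{α,β}(f;q;x)`. -/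
noncomputable def Tq (c : ℕ → ℝ) (q : ℝ) (n : ℕ) (t α β : ℝ) (f : ℝ → ℝ) (x : ℝ) : ℝ :=
  qExpE q (-(qInt q n * t)) / APow c 1 *
    ∑' k : ℕ, qAppell c q (qInt q n * t) k / qFact q k *
      f (x + (qInt q k + α) / (qInt q n + β))

/-- Statistical convergence of a real sequence to `l`. -/
def StatLim (x : ℕ → ℝ) (l : ℝ) : Prop :=
  ∀ ε > 0, Tendsto
    (fun n : ℕ => (((Finset.Icc 1 n).filter fun k => ε ≤ |x k - l|).card : ℝ) / n)
    atTop (nhds 0)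

/-- Modulus of continuity of `f` on `[0,∞)`. -/
noncomputable def modCont (f : ℝ → ℝ) (δ : ℝ) : ℝ :=
  sSup {r : ℝ | ∃ u v : ℝ, 0 ≤ u ∧ 0 ≤ v ∧ |u - v| ≤ δ ∧ r = |f u - f v|}

/-- Second-order modulus of smoothness of `f` on `[0,∞)`. -/
noncomputable def mod2 (f : ℝ → ℝ) (δ : ℝ) : ℝ :=
  sSup {r : ℝ | ∃ h x : ℝ, 0 < h ∧ h ≤ δ ∧ 0 ≤ x ∧
    r = |f (x + 2 * h) - 2 * f (x + h) + f x|}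

theorem aux_mod2_bdd (f : ℝ → ℝ) (M : ℝ) (hM : ∀ u : ℝ, 0 ≤ u → |f u| ≤ M) (δ : ℝ) (h x : ℝ)
    (hh : 0 ≤ h) (hd : h ≤ δ) (hx : 0 ≤ x) :
    |f (x + 2 * h) - 2 * f (x + h) + f x| ≤ mod2 f δ := by
  rcases hh.eq_or_lt with rfl | hh
  · have : f (x + 2 * 0) - 2 * f (x + 0) + f x = 0 := by simp; ring
    rw [this, abs_zero]
    apply Real.sSup_nonneg
    rintro r ⟨h, x, _, _, _, rfl⟩
    positivity
  · apply le_csSup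
    · refine ⟨4 * M, ?_⟩
      rintro r ⟨h, x, h1, h2, h3, rfl⟩
      have a1 := abs_le.1 (hM x h3)
      have a2 := abs_le.1 (hM (x + h) (by linarith))
      have a3 := abs_le.1 (hM (x + 2 * h) (by linarith))
      rw [abs_le]; constructor <;> linarith
    · exact ⟨h, x, hh, hd, hx, rfl⟩

theorem aux_interp (F : ℝ → ℝ) (a b W : ℝ) (hab : a ≤ b) (hF : ContinuousOn F (Set.Icc a b))
    (ha : F a = 0) (hb : F b = 0)
    (hW : ∀ x h, 0 ≤ h → a ≤ x → x + 2 * h ≤ b → |F (x + 2 * h) - 2 * F (x + h) + F x| ≤ W) :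
    ∀ s ∈ Set.Icc a b, |F s| ≤ W := by
  obtain ⟨p, hp, hmax⟩ := (isCompact_Icc (a := a) (b := b)).exists_isMaxOn
    ⟨a, by simp [hab]⟩ hF.abs
  have hmax' : ∀ s ∈ Set.Icc a b, |F s| ≤ |F p| := fun s hs => hmax hs
  intro s hs
  refine (hmax' s hs).trans ?_
  obtain ⟨hp1, hp2⟩ := hp
  have key : ∀ r ∈ Set.Icc a b, |F r - 2 * F p| ≤ W → |F p| ≤ W := by
    intro r hr h
    have h1 := abs_le.1 (hmax' r hr)
    have h2 := abs_le.1 h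
    rcases abs_cases (F p) with ⟨h3, _⟩ | ⟨h3, _⟩ <;> rw [h3] at h1 ⊢ <;> linarith
  rcases le_total (p - a) (b - p) with h | h
  · apply key (2 * p - a) ⟨by linarith, by linarith⟩
    have := hW a (p - a) (by linarith) le_rfl (by linarith)
    rw [ha] at this
    convert this using 2
    rw [show a + 2 * (p - a) = 2 * p - a by ring, show a + (p - a) = p by ring]; ring
  · apply key (2 * p - b) ⟨by linarith, by linarith⟩
    have := hW (2 * p - b) (b - p) (by linarith) (by linarith) (by linarith)
    rw [show 2 * p - b + 2 * (b - p) = b by ring, show 2 * p - b + (b - p) = p by ring, hb] at this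
    convert this using 2
    ring

theorem aux_seq (d : ℕ → ℝ) (W e : ℝ) (N : ℕ) (h0 : d 0 = 0) (h1 : |d 1| ≤ e)
    (h2 : ∀ k, k + 2 ≤ N → |d (k + 2) - 2 * d (k + 1) + d k| ≤ W) :
    |d N| ≤ N * e + N * (N - 1) / 2 * W := by
  have hdiff : ∀ k, k + 1 ≤ N → |d (k + 1) - d k| ≤ e + k * W := by
    intro k
    induction k with
    | zero => intro _; simpa [h0] using h1
    | succ k ih =>
      intro hk
      have a1 := abs_le.1 (ih (by omega))
      have a2 := abs_le.1 (h2 k (by omega))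
      rw [abs_le]; push_cast
      constructor <;> nlinarith
  have : ∀ k, k ≤ N → |d k| ≤ k * e + k * (k - 1) / 2 * W := by
    intro k
    induction k with
    | zero => intro _; simp [h0]
    | succ k ih =>
      intro hk
      have a1 := abs_le.1 (ih (by omega))
      have a2 := abs_le.1 (hdiff k (by omega))
      rw [abs_le]; push_cast
      constructor <;> nlinarith
  exact this N le_rfl

theorem aux_point (f : ℝ → ℝ) (hf : ContinuousOn f (Set.Ici 0)) (m δ W : ℝ) (hm : 0 ≤ m)
    (hδ : 0 < δ)
    (hW : ∀ x h, 0 ≤ h → h ≤ δ → 0 ≤ x → |f (x + 2 * h) - 2 * f (x + h) + f x| ≤ W) :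
    ∃ a : ℝ, ∀ s, 0 ≤ s → |f s - f m - a * (s - m)| ≤ 4 * (1 + (s - m) ^ 2 / δ ^ 2) * W := by
  have hW0 : 0 ≤ W := (abs_nonneg _).trans (hW 0 0 le_rfl hδ.le le_rfl)
  set a := (f (m + δ) - f m) / δ with ha
  refine ⟨a, ?_⟩
  set G : ℝ → ℝ := fun s => f s - f m - a * (s - m) with hG
  have hGW : ∀ x h, 0 ≤ h → h ≤ δ → 0 ≤ x → |G (x + 2 * h) - 2 * G (x + h) + G x| ≤ W := by
    intro x h h1 h2 h3
    convert hW x h h1 h2 h3 using 2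
    simp only [hG]; ring
  have hGm : G m = 0 := by simp [hG]
  have hGd : G (m + δ) = 0 := by simp only [hG, ha]; field_simp; ring
  have hGc : ContinuousOn G (Set.Icc m (m + δ)) := by
    have : ContinuousOn f (Set.Icc m (m + δ)) := hf.mono fun y hy => hm.trans hy.1
    fun_prop
  have hr : ∀ h, 0 ≤ h → h ≤ δ → |G (m + h)| ≤ W := by
    intro h h1 h2
    refine aux_interp G m (m + δ) W (by linarith) hGc hGm hGd ?_ _ ⟨by linarith, by linarith⟩
    intro x h h1 h2 h3
    exact hGW x h h1 (by linarith) (by linarith)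
  have hl : ∀ h, |h| ≤ δ → 0 ≤ m + h → |G (m + h)| ≤ 2 * W := by
    intro h h1 h2
    rcases le_total 0 h with h3 | h3
    · rw [abs_of_nonneg h3] at h1
      linarith [hr h h3 h1]
    · rw [abs_of_nonpos h3] at h1
      have b1 := abs_le.1 (hr (-h) (by linarith) h1)
      have b2 := abs_le.1 (hGW (m + h) (-h) (by linarith) h1 h2)
      rw [show m + h + 2 * -h = m + -h by ring, show m + h + -h = m by ring, hGm] at b2
      rw [abs_le]; constructor <;> linarith
  intro s hs
  change |G s| ≤ _
  by_cases hsm : s = m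
  · rw [hsm, hGm, abs_zero]; positivity
  set z := |s - m| / δ with hz
  have hz0 : 0 < z := div_pos (abs_pos.2 (sub_ne_zero.2 hsm)) hδ
  set N := ⌈z⌉₊ with hN
  have hN1 : z ≤ N := Nat.le_ceil z
  have hN2 : (N : ℝ) < z + 1 := Nat.ceil_lt_add_one hz0.le
  have hNp : (0 : ℝ) < N := hz0.trans_le hN1
  have hNp' : 1 ≤ N := by exact_mod_cast hNp
  set h := (s - m) / N with hh
  have hNh : N * h = s - m := by rw [hh]; field_simp
  have hhd : |h| ≤ δ := by
    rw [hh, abs_div, abs_of_pos hNp, div_le_iff₀ hNp]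
    rw [hz, div_le_iff₀ hδ] at hN1; linarith
  have hpos : ∀ k : ℕ, k ≤ N → 0 ≤ m + k * h := by
    intro k hk
    have hk' : (k : ℝ) ≤ N := by exact_mod_cast hk
    have hk0 : (0 : ℝ) ≤ k := by positivity
    rcases le_total 0 h with h3 | h3
    · positivity
    · nlinarith
  have := aux_seq (fun k => G (m + k * h)) W (2 * W) N (by simp [hGm])
    (by have := hl h hhd (by simpa using hpos 1 hNp'); simpa using this)
    (by
      intro k hk
      have p0 := hpos k (by omega)
      have p2 := hpos (k + 2) hk
      push_cast at p2 ⊢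
      rcases le_total 0 h with h3 | h3
      · rw [abs_of_nonneg h3] at hhd
        have := hGW (m + k * h) h h3 hhd p0
        convert this using 4 <;> ring_nf
      · rw [abs_of_nonpos h3] at hhd
        have := hGW (m + (k + 2) * h) (-h) (by linarith) hhd p2
        rw [show m + (k + 2) * h + 2 * -h = m + k * h by ring,
          show m + (k + 2) * h + -h = m + (k + 1) * h by ring] at this
        convert this using 2
        ring)
  simp only [hNh, add_sub_cancel] at this
  have hz2 : (s - m) ^ 2 / δ ^ 2 = z ^ 2 := by rw [hz, div_pow, sq_abs]
  rw [hz2]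
  refine this.trans ?_
  have : (N : ℝ) * 2 + N * (N - 1) / 2 ≤ 4 * (1 + z ^ 2) := by
    nlinarith [sq_nonneg (z - 1)]
  nlinarith

theorem aux_hs {g g' : ℕ → ℝ} {a a' : ℝ} (h : HasSum g a) (hg : ∀ k, g' k = g k) (ha : a' = a) :
    HasSum g' a' := by
  rw [ha, funext hg]; exact h

theorem aux_prob (f : ℝ → ℝ) (hf : ContinuousOn f (Set.Ici 0)) (m δ W : ℝ) (hm : 0 ≤ m)
    (hδ : 0 < δ)
    (hW : ∀ x h, 0 ≤ h → h ≤ δ → 0 ≤ x → |f (x + 2 * h) - 2 * f (x + h) + f x| ≤ W)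
    (w s : ℕ → ℝ) (hw : ∀ k, 0 ≤ w k) (hs : ∀ k, 0 ≤ s k) (v I : ℝ) (hw1 : HasSum w 1)
    (hwm : HasSum (fun k => w k * s k) m) (hwv : HasSum (fun k => w k * (s k - m) ^ 2) v)
    (hv : v ≤ δ ^ 2) (hI : HasSum (fun k => w k * f (s k)) I) :
    |I - f m| ≤ 8 * W := by
  have hW0 : 0 ≤ W := (abs_nonneg _).trans (hW 0 0 le_rfl hδ.le le_rfl)
  obtain ⟨a, ha⟩ := aux_point f hf m δ W hm hδ hW
  have h1 : HasSum (fun k => w k * (f (s k) - f m - a * (s k - m))) (I - f m) := by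
    have := (hI.sub (hw1.mul_left (f m))).sub ((hwm.sub (hw1.mul_left m)).mul_left a)
    refine aux_hs this (fun k => ?_) ?_
    · ring
    · ring
  have h2 : HasSum (fun k => w k * (4 * (1 + (s k - m) ^ 2 / δ ^ 2) * W))
      (4 * (1 + v / δ ^ 2) * W) := by
    have := ((hw1.add (hwv.div_const (δ ^ 2))).mul_left 4).mul_right W
    refine aux_hs this (fun k => ?_) rfl
    ring
  have h3 : v / δ ^ 2 ≤ 1 := by rw [div_le_one (by positivity)]; exact hv
  have h4 : 4 * (1 + v / δ ^ 2) * W ≤ 8 * W := by nlinarith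
  refine le_trans ?_ h4
  rw [abs_le]
  constructor
  · refine hasSum_le (fun k => ?_) h2.neg h1
    have := (abs_le.1 (ha (s k) (hs k))).1
    nlinarith [hw k]
  · refine hasSum_le (fun k => ?_) h1 h2
    exact mul_le_mul_of_nonneg_left (abs_le.1 (ha (s k) (hs k))).2 (hw k)

theorem aux_qInt_pos (q : ℝ) (h0 : 0 < q) (h1 : q < 1) (k : ℕ) : 0 < qInt q (k + 1) := by
  have : q ^ (k + 1) < 1 := pow_lt_one₀ h0.le h1 (by omega)
  unfold qInt; apply div_pos <;> linarith

theorem aux_qFact_pos (q : ℝ) (h0 : 0 < q) (h1 : q < 1) (k : ℕ) : 0 < qFact q k :=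
  Finset.prod_pos fun i _ => aux_qInt_pos q h0 h1 i

theorem aux_qFact_succ (q : ℝ) (k : ℕ) : qFact q (k + 1) = qFact q k * qInt q (k + 1) := by
  unfold qFact; rw [Finset.prod_range_succ]

theorem aux_summ (q y : ℝ) (h0 : 0 < q) (h1 : q < 1) (hy : 0 ≤ y) (hy1 : (1 - q) * y < 1) :
    Summable fun n : ℕ => y ^ n / qFact q n := by
  obtain ⟨r, hr1, hr2⟩ := exists_between hy1
  have hr0 : 0 < r := lt_of_le_of_lt (mul_nonneg (by linarith) hy) hr1
  refine summable_of_ratio_norm_eventually_le (r := r) hr2 ?_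
  have ht : Tendsto (fun n : ℕ => r * (1 - q ^ (n + 1))) atTop (nhds (r * (1 - 0))) :=
    (((tendsto_pow_atTop_nhds_zero_of_lt_one h0.le h1).comp (tendsto_add_atTop_nat 1)).const_sub
      1).const_mul r
  filter_upwards [ht.eventually (lt_mem_nhds (by linarith : (1 - q) * y < r * (1 - 0)))] with n hn
  have hp := aux_qInt_pos q h0 h1 n
  have hf := aux_qFact_pos q h0 h1 n
  rw [aux_qFact_succ, Real.norm_of_nonneg (by positivity), Real.norm_of_nonneg (by positivity)]
  have : y / qInt q (n + 1) ≤ r := by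
    rw [div_le_iff₀ hp, qInt, mul_div_assoc', le_div_iff₀ (by linarith)]
    linarith
  calc y ^ (n + 1) / (qFact q n * qInt q (n + 1)) = y / qInt q (n + 1) * (y ^ n / qFact q n) := by
        rw [pow_succ]; field_simp
    _ ≤ _ := by gcongr

theorem aux_summE (q y : ℝ) (h0 : 0 < q) (h1 : q < 1) (hy : 0 ≤ y) (hy1 : (1 - q) * y < 1) :
    Summable fun n : ℕ => q ^ (n * (n - 1) / 2) * (-y) ^ n / qFact q n := by
  refine Summable.of_norm_bounded (aux_summ q y h0 h1 hy hy1) fun n => ?_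
  have hf := aux_qFact_pos q h0 h1 n
  rw [norm_div, norm_mul, norm_pow, norm_pow, norm_neg, Real.norm_of_nonneg hy,
    Real.norm_of_nonneg h0.le, Real.norm_of_nonneg hf.le]
  gcongr
  have : q ^ (n * (n - 1) / 2) ≤ 1 := pow_le_one₀ h0.le h1.le
  nlinarith [pow_nonneg hy n]

theorem aux_e_func (q y : ℝ) (h0 : 0 < q) (h1 : q < 1) (hy : 0 ≤ y) (hy1 : (1 - q) * y < 1) :
    qExp q (q * y) = (1 - (1 - q) * y) * qExp q y := by
  have hq : 0 < 1 - q := by linarith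
  have s1 := aux_summ q y h0 h1 hy hy1
  have s2 := aux_summ q (q * y) h0 h1 (by positivity) (by nlinarith [mul_nonneg hq.le hy])
  have e1 : qExp q y - qExp q (q * y) = (1 - q) * y * qExp q y := by
    unfold qExp
    rw [← s1.tsum_sub s2, (s1.sub s2).tsum_eq_zero_add, ← tsum_mul_left]
    simp only [pow_zero, sub_self, zero_add]
    refine tsum_congr fun n => ?_
    have hp := (aux_qInt_pos q h0 h1 n).ne'
    have hf := (aux_qFact_pos q h0 h1 n).ne'
    have hi : qInt q (n + 1) * (1 - q) = 1 - q ^ (n + 1) := by unfold qInt; field_simp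
    rw [aux_qFact_succ, mul_pow, ← sub_div,
      show y ^ (n + 1) - q ^ (n + 1) * y ^ (n + 1) = (1 - q ^ (n + 1)) * y ^ (n + 1) by ring, ← hi, pow_succ y]
    field_simp
  linarith

theorem aux_E_func (q y : ℝ) (h0 : 0 < q) (h1 : q < 1) (hy : 0 ≤ y) (hy1 : (1 - q) * y < 1) :
    qExpE q (-y) = (1 - (1 - q) * y) * qExpE q (-(q * y)) := by
  have hq : 0 < 1 - q := by linarith
  have s1 := aux_summE q y h0 h1 hy hy1
  have s2 := aux_summE q (q * y) h0 h1 (by positivity) (by nlinarith [mul_nonneg hq.le hy])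
  have e1 : qExpE q (-y) - qExpE q (-(q * y)) = -((1 - q) * y) * qExpE q (-(q * y)) := by
    unfold qExpE
    rw [← s1.tsum_sub s2, (s1.sub s2).tsum_eq_zero_add, ← tsum_mul_left]
    simp only [pow_zero, sub_self, zero_add]
    refine tsum_congr fun n => ?_
    have hp := (aux_qInt_pos q h0 h1 n).ne'
    have hf := (aux_qFact_pos q h0 h1 n).ne'
    have hi : qInt q (n + 1) * (1 - q) = 1 - q ^ (n + 1) := by unfold qInt; field_simp
    have ht : (n + 1) * (n + 1 - 1) / 2 = n * (n - 1) / 2 + n := by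
      have := Nat.triangle_succ n
      omega
    rw [aux_qFact_succ, ht, ← sub_div,
      show q ^ (n * (n - 1) / 2 + n) * (-y) ^ (n + 1)
        - q ^ (n * (n - 1) / 2 + n) * (-(q * y)) ^ (n + 1)
        = (1 - q ^ (n + 1)) * (q ^ (n * (n - 1) / 2 + n) * (-y) ^ (n + 1)) by
          rw [neg_mul_eq_mul_neg q y, mul_pow]; ring, ← hi]
    rw [neg_mul_eq_mul_neg q y, mul_pow, pow_add, pow_succ (-y)]
    field_simp
  linarith

theorem aux_eE (q y : ℝ) (h0 : 0 < q) (h1 : q < 1) (hy : 0 ≤ y) (hy1 : (1 - q) * y < 1) :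
    qExp q y * qExpE q (-y) = 1 := by
  have hq : 0 < 1 - q := by linarith
  have hle : ∀ N : ℕ, q ^ N * y ≤ y := fun N => by
    have : q ^ N ≤ 1 := pow_le_one₀ h0.le h1.le
    nlinarith
  have hN0 : ∀ N : ℕ, 0 ≤ q ^ N * y := fun N => by positivity
  have hN1 : ∀ N : ℕ, (1 - q) * (q ^ N * y) < 1 := fun N => by nlinarith [hle N]
  have hconst : ∀ N : ℕ, qExp q (q ^ N * y) * qExpE q (-(q ^ N * y)) = qExp q y * qExpE q (-y) := by
    intro N
    induction N with
    | zero => simp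
    | succ N ih =>
      rw [← ih, aux_E_func q (q ^ N * y) h0 h1 (hN0 N) (hN1 N), pow_succ',
        mul_assoc q, aux_e_func q (q ^ N * y) h0 h1 (hN0 N) (hN1 N)]
      ring
  have hy0 : Tendsto (fun N : ℕ => q ^ N * y) atTop (nhds 0) := by
    simpa using (tendsto_pow_atTop_nhds_zero_of_lt_one h0.le h1).mul_const y
  have l1 : Tendsto (fun N : ℕ => qExp q (q ^ N * y)) atTop (nhds 1) := by
    have : ∑' n : ℕ, (0 : ℝ) ^ n / qFact q n = 1 := by
      rw [tsum_eq_single 0 (by intro n hn; simp [hn])]; simp [qFact]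
    rw [← this]
    refine tendsto_tsum_of_dominated_convergence (aux_summ q y h0 h1 hy hy1) ?_ ?_
    · intro n
      exact (hy0.pow n).div_const _
    · refine Eventually.of_forall fun N n => ?_
      have hf := aux_qFact_pos q h0 h1 n
      rw [Real.norm_of_nonneg (by have := hN0 N; positivity)]
      have := hN0 N
      gcongr
      exact hle N
  have l2 : Tendsto (fun N : ℕ => qExpE q (-(q ^ N * y))) atTop (nhds 1) := by
    have : ∑' n : ℕ, q ^ (n * (n - 1) / 2) * (-0 : ℝ) ^ n / qFact q n = 1 := by
      rw [tsum_eq_single 0 (by intro n hn; simp [hn])]; simp [qFact]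
    rw [← this]
    refine tendsto_tsum_of_dominated_convergence (aux_summ q y h0 h1 hy hy1) ?_ ?_
    · intro n
      exact ((hy0.neg.pow n).const_mul _).div_const _
    · refine Eventually.of_forall fun N n => ?_
      have hf := aux_qFact_pos q h0 h1 n
      have := hN0 N
      rw [norm_div, norm_mul, norm_pow, norm_pow, norm_neg, Real.norm_of_nonneg this,
        Real.norm_of_nonneg h0.le, Real.norm_of_nonneg hf.le]
      gcongr
      calc q ^ (n * (n - 1) / 2) * (q ^ N * y) ^ n ≤ 1 * y ^ n := by
            gcongr
            · exact pow_le_one₀ h0.le h1.le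
            · exact hle N
        _ = y ^ n := one_mul _
  have := l1.mul l2
  simp only [hconst, mul_one] at this
  exact tendsto_nhds_unique tendsto_const_nhds this

theorem aux_cauchy (c : ℕ → ℝ) (hc : ∀ k, 0 ≤ c k) (q y u : ℝ) (h0 : 0 < q) (h1 : q < 1)
    (hy : 0 ≤ y) (hu0 : 0 ≤ u) (hu1 : u ≤ 1) (hy1 : (1 - q) * y < 1) (hs : Summable c) :
    HasSum (fun k => qAppell c q y k / qFact q k * u ^ k) (APow c u * qExp q (u * y)) := by
  have hq : 0 < 1 - q := by linarith
  have s1 : Summable fun k => c k * u ^ k :=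
    Summable.of_nonneg_of_le (fun k => mul_nonneg (hc k) (by positivity))
      (fun k => mul_le_of_le_one_right (hc k) (pow_le_one₀ hu0 hu1)) hs
  have s2 := aux_summ q (u * y) h0 h1 (by positivity) (by nlinarith [mul_nonneg hq.le hy])
  have a1 := summable_norm_sum_mul_range_of_summable_norm s1.norm s2.norm
  have a2 := tsum_mul_tsum_eq_tsum_sum_range_of_summable_norm s1.norm s2.norm
  have hh := a1.of_norm.hasSum
  rw [← a2] at hh
  refine aux_hs hh (fun k => ?_) rfl
  have hf := (aux_qFact_pos q h0 h1 k).ne'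
  rw [qAppell, mul_div_cancel_left₀ _ hf, Finset.sum_mul]
  refine Finset.sum_congr rfl fun j hj => ?_
  have hj' : j ≤ k := by simp at hj; omega
  rw [mul_pow]
  have hk : u ^ k = u ^ j * u ^ (k - j) := by rw [← pow_add]; congr 1; omega
  rw [hk]
  ring

/-- there is an absolute constant `C > 0` such that
    `|T_{n,t}^{α,β}(f;q;x) − f(x+t)| ≤ C ω₂(f, δ_{n,t}(x)) + ω(f, |u_{n,t} − t|)` where
    `u_{n,t} = ([n]_q t + α + R_{n,t} D_qA(1))/([n]_q+β)` and
    `δ_{n,t}(x) = (T((s−(x+t))²;q;x) + (u_{n,t} − t)²)^{1/2}`. -/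
theorem stmt_14 :
    ∃ C : ℝ, 0 < C ∧
      ∀ (c : ℕ → ℝ), (∀ k, 0 ≤ c k) →
        (∃ R : ℝ, 1 < R ∧ Summable fun k => c k * R ^ k) → 0 < APow c 1 →
      ∀ q : ℝ, 0 < q → q < 1 →
      ∀ α β : ℝ, 0 ≤ α → 0 ≤ β →
      ∀ n : ℕ, 1 ≤ n → ∀ t : ℝ, 0 ≤ t → (1 - q ^ n) * t < 1 →
      ∀ f : ℝ → ℝ, ContinuousOn f (Set.Ici 0) → (∃ M : ℝ, ∀ u : ℝ, 0 ≤ u → |f u| ≤ M) →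
      ∀ x : ℝ, 0 ≤ x →
      |Tq c q n t α β f x - f (x + t)| ≤
        C * mod2 f (Real.sqrt
            (Tq c q n t α β (fun s => (s - (x + t)) ^ 2) x +
              ((qInt q n * t + α
                  + (qExp q (q * (qInt q n * t)) * qExpE q (-(qInt q n * t)) / APow c 1)
                    * DqA1 c q) / (qInt q n + β) - t) ^ 2))
          + modCont f
              |(qInt q n * t + α
                  + (qExp q (q * (qInt q n * t)) * qExpE q (-(qInt q n * t)) / APow c 1)
                    * DqA1 c q) / (qInt q n + β) - t| := by
  refine ⟨8, by norm_num, ?_⟩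
  intro c hc ⟨R, hR, hsR⟩ hA q h0 h1 α β hα hβ n hn t ht htn f hf ⟨M, hM⟩ x hx
  have hq : 0 < 1 - q := by linarith
  have hsc : Summable c := Summable.of_nonneg_of_le hc
    (fun k => le_mul_of_one_le_right (hc k) (one_le_pow₀ hR.le)) hsR
  have hn0 : 0 < qInt q n := by
    obtain ⟨k, rfl⟩ : ∃ k, n = k + 1 := ⟨n - 1, by omega⟩
    exact aux_qInt_pos q h0 h1 k
  set y := qInt q n * t with hydef
  have hy : 0 ≤ y := by positivity
  have hy1 : (1 - q) * y < 1 := by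
    have : (1 - q) * y = (1 - q ^ n) * t := by rw [hydef, qInt]; field_simp
    linarith
  have heE := aux_eE q y h0 h1 hy hy1
  have hef := aux_e_func q y h0 h1 hy hy1
  have hB : 0 < qInt q n + β := by linarith
  have hc1 := aux_cauchy c hc q y 1 h0 h1 hy zero_le_one le_rfl hy1 hsc
  have hcq := aux_cauchy c hc q y q h0 h1 hy h0.le h1.le hy1 hsc
  simp only [one_pow, mul_one, one_mul] at hc1
  have he0 : 0 ≤ qExp q y := tsum_nonneg fun k => by
    have := aux_qFact_pos q h0 h1 k; positivity
  have hE0 : 0 < qExpE q (-y) := by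
    by_contra h
    nlinarith [not_lt.1 h]
  set w : ℕ → ℝ := fun k => qExpE q (-y) / APow c 1 * (qAppell c q y k / qFact q k) with hwdef
  have hw : ∀ k, 0 ≤ w k := by
    intro k
    have hk := aux_qFact_pos q h0 h1 k
    have : 0 ≤ qAppell c q y k := by
      refine mul_nonneg hk.le (Finset.sum_nonneg fun j _ => ?_)
      have := hc j
      have := aux_qFact_pos q h0 h1 (k - j)
      positivity
    simp only [hwdef]; positivity
  have hw1 : HasSum w 1 := by
    refine aux_hs (hc1.mul_left (qExpE q (-y) / APow c 1)) (fun k => rfl) ?_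
    field_simp; linarith
  set r := 1 - (1 - q) * y with hr
  have hwq : HasSum (fun k => w k * q ^ k) (r * APow c q / APow c 1) := by
    refine aux_hs (hcq.mul_left (qExpE q (-y) / APow c 1)) (fun k => ?_) ?_
    · simp only [hwdef]; ring
    · rw [hef]; field_simp
      linear_combination (-(r * APow c q)) * heE
  set s : ℕ → ℝ := fun k => x + (qInt q k + α) / (qInt q n + β) with hsdef
  have hs0 : ∀ k, 0 ≤ s k := by
    intro k
    have : 0 ≤ qInt q k := div_nonneg (sub_nonneg.2 (pow_le_one₀ h0.le h1.le)) hq.le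
    simp only [hsdef]; positivity
  set u := (y + α + (qExp q (q * y) * qExpE q (-y) / APow c 1) * DqA1 c q) / (qInt q n + β) with hu
  have hwm : HasSum (fun k => w k * s k) (x + u) := by
    have := (hw1.mul_left x).add
      ((((hw1.sub hwq).div_const (1 - q)).add (hw1.mul_left α)).div_const (qInt q n + β))
    refine aux_hs this (fun k => ?_) ?_
    · simp only [hsdef, qInt]; ring
    · have e1 : qExp q (q * y) * qExpE q (-y) = r := by
        rw [hef]; linear_combination r * heE
      rw [hu, e1, DqA1]
      rw [mul_one, mul_one]
      congr 2
      field_simp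
      rw [hr]; ring
  have hwI : ∀ (g : ℝ → ℝ) (K : ℝ), (∀ k, |g (s k)| ≤ K) →
      HasSum (fun k => w k * g (s k)) (Tq c q n t α β g x) := by
    intro g K hK
    have hsum : Summable (fun k => w k * g (s k)) := by
      refine Summable.of_norm_bounded (hw1.summable.mul_right K) fun k => ?_
      rw [norm_mul, Real.norm_of_nonneg (hw k)]
      exact mul_le_mul_of_nonneg_left (hK k) (hw k)
    refine aux_hs hsum.hasSum (fun k => rfl) ?_
    rw [Tq, ← tsum_mul_left]
    refine tsum_congr fun k => ?_
    simp only [hwdef, hsdef, ← hydef]; ring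
  have hsb : ∀ k, s k ≤ x + (1 / (1 - q) + α) / (qInt q n + β) := by
    intro k
    simp only [hsdef, qInt]
    have : 0 ≤ q ^ k := by positivity
    gcongr
    linarith
  set Bd := x + (1 / (1 - q) + α) / (qInt q n + β) with hBd
  have hT2 := hwI (fun s => (s - (x + t)) ^ 2) ((Bd + (x + t)) ^ 2) (by
    intro k
    have a1 := hsb k
    have a2 := hs0 k
    rw [abs_of_nonneg (by positivity)]
    apply sq_le_sq'
    · linarith
    · linarith)
  have hTf := hwI f M fun k => hM _ (hs0 k)
  set V := Tq c q n t α β (fun s => (s - (x + t)) ^ 2) x with hV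
  set I := Tq c q n t α β f x with hIdef
  have hm0 : 0 ≤ x + u := hwm.nonneg fun k => mul_nonneg (hw k) (hs0 k)
  have hV0 : 0 ≤ V := hT2.nonneg fun k => mul_nonneg (hw k) (sq_nonneg _)
  have hwv : HasSum (fun k => w k * (s k - (x + u)) ^ 2) (V - (u - t) ^ 2) := by
    have := (hT2.add ((hwm.sub (hw1.mul_left (x + t))).mul_left (-2 * (u - t)))).add
      (hw1.mul_left ((u - t) ^ 2))
    refine aux_hs this (fun k => ?_) ?_
    · ring
    · ring
  have hmc : |f (x + u) - f (x + t)| ≤ modCont f |u - t| := by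
    apply le_csSup
    · refine ⟨2 * M, ?_⟩
      rintro r ⟨a, b, ha, hb, _, rfl⟩
      have a1 := abs_le.1 (hM a ha)
      have a2 := abs_le.1 (hM b hb)
      rw [abs_le]; constructor <;> linarith
    · exact ⟨x + u, x + t, hm0, by positivity, le_of_eq (by congr 1; ring), rfl⟩
  have hmain : |I - f (x + u)| ≤ 8 * mod2 f (Real.sqrt (V + (u - t) ^ 2)) := by
    have hS0 : 0 ≤ V + (u - t) ^ 2 := by positivity
    rcases hS0.eq_or_lt with hz | hpos
    · have hV' : V = 0 := by nlinarith [sq_nonneg (u - t)]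
      have hut : u = t := by
        have : (u - t) ^ 2 = 0 := by linarith
        have := pow_eq_zero_iff (two_ne_zero) |>.1 this
        linarith
      rw [hV'] at hT2
      have hz0 := (hasSum_zero_iff_of_nonneg fun k => mul_nonneg (hw k) (sq_nonneg _)).1 hT2
      have : HasSum (fun k => w k * f (s k)) (1 * f (x + t)) := by
        refine aux_hs (hw1.mul_right (f (x + t))) (fun k => ?_) rfl
        have := congrFun hz0 k
        simp only [Pi.zero_apply, mul_eq_zero] at this
        rcases this with h | h
        · simp [h]
        · have := pow_eq_zero_iff (two_ne_zero) |>.1 h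
          rw [show s k = x + t by linarith]
      rw [hTf.unique this, hut]
      simp only [one_mul, sub_self, abs_zero]
      refine mul_nonneg (by norm_num) (Real.sSup_nonneg ?_)
      rintro r ⟨h, x, _, _, _, rfl⟩
      positivity
    · refine aux_prob f hf (x + u) (Real.sqrt (V + (u - t) ^ 2)) _ hm0 (Real.sqrt_pos.2 hpos)
        (fun x h hh hd hx => aux_mod2_bdd f M hM _ h x hh hd hx) w s hw hs0 _ I hw1 hwm hwv ?_ hTf
      rw [Real.sq_sqrt hS0]
      nlinarith [sq_nonneg (u - t)]
  calc |I - f (x + t)| ≤ |I - f (x + u)| + |f (x + u) - f (x + t)| := abs_sub_le _ _ _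
    _ ≤ _ := add_le_add hmain hmc
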